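/- Let Ω = [0,1] × [√3−2, √3] and define the natural extension map 𝑇̄ : Ω → Ω by 𝑇̄(x,y) = (T(x), bar h_{A}(y)) whenever x lies in the branch interval I_A for A ∈ 𝒜. Then the measure on Ω with density (x,y) ↦ 1/(log(2+√3)·(1+xy)²) with respect to two-dimensional Lebesgue measure is a probability measure and is invariant under 𝑇̄. -/

import Mathlib

open MeasureTheory Real Set Filter Topology

namespace SCF

/-- The involution `ι(x) = (1−x)/(1+x)`. -/
noncomputable def iota (x : ℝ) : ℝ := (1 - x) / (1 + x)

/-- Even continued-fraction step.  For `y ∈ (0,1/2]` one has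
`⌊(1/y+1)/2⌋ = k` whenever `1/y ∈ (2k−1, 2k+1)`, so `Te y = |1/y − 2k|`;
explicitly `Te y = 1/y − 2` on `[1/3,1/2]`, `Te y = 1/y − 2k` on
`[1/(2k+1), 1/(2k))` and `Te y = 2k − 1/y` on `[1/(2k), 1/(2k−1))` (`k ≥ 2`). -/
noncomputable def Te (y : ℝ) : ℝ := |1 / y - 2 * (⌊(1 / y + 1) / 2⌋ : ℝ)|

/-- The spliced continued fraction (SCF) map `T : [0,1] → [0,1]`, with
`T 0 = 0`, `T 1 = 1`.  On `(0,1/2]` it is the even continued fraction map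
(see `Te`), and on `(1/2,1)` it is the odd–odd map, which is the conjugate
`ι ∘ Te ∘ ι` of the even map; this agrees with the branchwise definition:
`T x = (k x − (k−1))/(k − (k+1) x)` on `((k−1)/k, (2k−1)/(2k+1)]` and
`T x = (k − (k+1) x)/(k x − (k−1))` on `((2k−1)/(2k+1), k/(k+1)]` for `k ≥ 2`. -/
noncomputable def T (x : ℝ) : ℝ :=
  if x ≤ 0 then 0
  else if 1 ≤ x then 1
  else if x ≤ 1 / 2 then Te x
  else iota (Te (iota x))

/-- Parity label of a digit: `e` (even cusp) or `o` (odd–odd cusp). -/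
inductive Par | e | o
deriving DecidableEq

/-- A candidate SCF digit `(a, ε)_s`. -/
structure Digit where
  a : ℤ
  eps : ℤ
  s : Par
deriving DecidableEq

/-- The digit set `𝒜 = {(k,ε)_s : k ≥ 2, ε = ±1, s ∈ {e,o}} ∪ {(1,+1)_e}`. -/
def Digit.Valid (d : Digit) : Prop :=
  (2 ≤ d.a ∧ (d.eps = 1 ∨ d.eps = -1)) ∨ (d.a = 1 ∧ d.eps = 1 ∧ d.s = Par.e)

/-- The branch intervals `I_{(a,ε)_s}` of the SCF map. -/
noncomputable def branch (d : Digit) : Set ℝ :=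
  match d.s with
  | Par.e =>
      if d.a = 1 then Set.Icc (1/3 : ℝ) (1/2)
      else if d.eps = 1 then Set.Ico (1 / (2 * (d.a : ℝ) + 1)) (1 / (2 * (d.a : ℝ)))
      else Set.Ico (1 / (2 * (d.a : ℝ))) (1 / (2 * (d.a : ℝ) - 1))
  | Par.o =>
      if d.eps = 1 then
        Set.Ioc ((2 * (d.a : ℝ) - 1) / (2 * (d.a : ℝ) + 1)) ((d.a : ℝ) / ((d.a : ℝ) + 1))
      else
        Set.Ioc (((d.a : ℝ) - 1) / (d.a : ℝ)) ((2 * (d.a : ℝ) - 1) / (2 * (d.a : ℝ) + 1))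

open Classical in
/-- The SCF digit of a point `y` (the unique valid digit `d` with `y ∈ I_d`;
well defined for every `y ∈ (0,1)`). -/
noncomputable def digit (y : ℝ) : Digit :=
  if h : ∃ d : Digit, d.Valid ∧ y ∈ branch d then h.choose else ⟨1, 1, Par.e⟩

/-- The `n`-th SCF digit `(a_n(x), ε_n(x))_{s_n(x)}` of `x`, `n ≥ 1`,
determined by `T^[n−1] x ∈ I_{(a_n,ε_n)_{s_n}}`. -/
noncomputable def dig (n : ℕ) (x : ℝ) : Digit := digit (T^[n - 1] x)

/-- The `n`-th SCF partial quotient `a_n(x)`. -/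
noncomputable def a (n : ℕ) (x : ℝ) : ℤ := (dig n x).a

/-- The invariant density `f_μ`. -/
noncomputable def fdens (x : ℝ) : ℝ :=
  2 / (Real.log (2 + Real.sqrt 3) * (1 - (2 - Real.sqrt 3) * x) * (1 + Real.sqrt 3 * x))

/-- The absolutely continuous `T`-invariant probability measure `μ` on `(0,1)`. -/
noncomputable def mu : Measure ℝ :=
  (volume.restrict (Set.Ioo (0 : ℝ) 1)).withDensity fun x => ENNReal.ofReal (fdens x)

/-- The inverse branches `h_{(a,ε)_s}` of the SCF map `T`. -/
noncomputable def h (d : Digit) (x : ℝ) : ℝ :=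
  match d.s with
  | Par.e => 1 / (2 * (d.a : ℝ) + (d.eps : ℝ) * x)
  | Par.o =>
      if d.eps = 1 then (((d.a : ℝ) - 1) * x + (d.a : ℝ)) / ((d.a : ℝ) * x + ((d.a : ℝ) + 1))
      else ((d.a : ℝ) * x + ((d.a : ℝ) - 1)) / (((d.a : ℝ) + 1) * x + (d.a : ℝ))

/-- Composed inverse branch `h_{A^{(n)}} = h_{A₁} ∘ ⋯ ∘ h_{A_n}` of a word. -/
noncomputable def hWord (l : List Digit) : ℝ → ℝ :=
  l.foldr (fun d g => h d ∘ g) id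

/-- The dual inverse branches `bar h_{(b,η)_t}`. -/
noncomputable def hbar (d : Digit) (y : ℝ) : ℝ :=
  match d.s with
  | Par.e => (d.eps : ℝ) / (2 * (d.a : ℝ) + y)
  | Par.o =>
      1 / (1 + (d.eps : ℝ) / (((d.a : ℝ) - ((max 0 d.eps : ℤ) : ℝ)) + 1 / (1 + y)))

/-- The matrix `M_{(a,ε)_s}` associated with the inverse branch `h_{(a,ε)_s}`. -/
noncomputable def Mdig (d : Digit) : Matrix (Fin 2) (Fin 2) ℝ :=
  match d.s with
  | Par.e => !![0, 1; (d.eps : ℝ), 2 * (d.a : ℝ)]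
  | Par.o =>
      !![(d.a : ℝ) - ((max 0 d.eps : ℤ) : ℝ), (d.a : ℝ) - ((max 0 d.eps : ℤ) : ℝ) + (d.eps : ℝ);
         (d.a : ℝ) - ((max 0 d.eps : ℤ) : ℝ) + 1, (d.a : ℝ) - ((max 0 d.eps : ℤ) : ℝ) + (d.eps : ℝ) + 1]

/-- `M_n(x) = M_{(a₁,ε₁)_{s₁}} ⋯ M_{(a_n,ε_n)_{s_n}}`. -/
noncomputable def Mn (n : ℕ) (x : ℝ) : Matrix (Fin 2) (Fin 2) ℝ :=
  ((List.range n).map fun i => Mdig (digit (T^[i] x))).prod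

/-- `P_n(x)`: the `(1,2)`-entry of `M_n(x)` (numerator of the `n`-th convergent). -/
noncomputable def Pc (n : ℕ) (x : ℝ) : ℝ := Mn n x 0 1

/-- `Q_n(x)`: the `(2,2)`-entry of `M_n(x)` (denominator of the `n`-th convergent). -/
noncomputable def Qc (n : ℕ) (x : ℝ) : ℝ := Mn n x 1 1


/-- The natural extension map `𝑇̄(x,y) = (T x, bar h_A y)` for `x ∈ I_A`. -/
noncomputable def Tbar (p : ℝ × ℝ) : ℝ × ℝ := (T p.1, hbar (digit p.1) p.2)

/-- The measure on `Ω = [0,1] × [√3−2,√3]` with density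
`1/(log(2+√3)(1+xy)²)` with respect to 2-dimensional Lebesgue measure. -/
noncomputable def mubar : Measure (ℝ × ℝ) :=
  (volume.restrict
      ((Set.Icc (0 : ℝ) 1) ×ˢ (Set.Icc (Real.sqrt 3 - 2) (Real.sqrt 3)))).withDensity
    fun p => ENNReal.ofReal (1 / (Real.log (2 + Real.sqrt 3) * (1 + p.1 * p.2) ^ 2))

/-- The invariant density. -/
noncomputable def gden (p : ℝ × ℝ) : ENNReal :=
  ENNReal.ofReal (1 / (Real.log (2 + Real.sqrt 3) * (1 + p.1 * p.2) ^ 2))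

/-- A Moebius map together with its dual. -/
noncomputable def Phi (α β γ δ : ℝ) (p : ℝ × ℝ) : ℝ × ℝ :=
  ((α * p.1 + β) / (γ * p.1 + δ), (δ * p.2 - γ) / (α - β * p.2))

theorem lintegral_Phi (α β γ δ : ℝ) (hD : α * δ - β * γ ≠ 0) (s : Set (ℝ × ℝ))
    (hs : MeasurableSet s) (h1 : ∀ p ∈ s, γ * p.1 + δ ≠ 0) (h2 : ∀ p ∈ s, α - β * p.2 ≠ 0) :
    MeasurableSet (Phi α β γ δ '' s) ∧
    ∫⁻ p in Phi α β γ δ '' s, gden p = ∫⁻ p in s, gden p := by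
  have hinj : InjOn (Phi α β γ δ) s := by
    rintro ⟨x, y⟩ hp ⟨x', y'⟩ hp' he
    have a1 := h1 _ hp
    have a2 := h2 _ hp
    have b1 := h1 _ hp'
    have b2 := h2 _ hp'
    simp only [Phi, Prod.mk.injEq] at he a1 a2 b1 b2 ⊢
    obtain ⟨e1, e2⟩ := he
    rw [div_eq_div_iff a1 b1] at e1
    rw [div_eq_div_iff a2 b2] at e2
    constructor
    · apply mul_left_cancel₀ hD; linear_combination e1
    · apply mul_left_cancel₀ hD; linear_combination e2
  let u' : ℝ × ℝ → ℝ := fun p => (α * δ - β * γ) / (γ * p.1 + δ) ^ 2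
  let v' : ℝ × ℝ → ℝ := fun p => (α * δ - β * γ) / (α - β * p.2) ^ 2
  let f' : ℝ × ℝ → (ℝ × ℝ →L[ℝ] ℝ × ℝ) := fun p =>
    (ContinuousLinearMap.toSpanSingleton ℝ (u' p)).prodMap
      (ContinuousLinearMap.toSpanSingleton ℝ (v' p))
  have hder : ∀ p ∈ s, HasFDerivWithinAt (Phi α β γ δ) (f' p) s p := by
    intro p hp
    apply HasFDerivAt.hasFDerivWithinAt
    have d1 : HasDerivAt (fun x : ℝ => (α * x + β) / (γ * x + δ)) (u' p) p.1 := by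
      have n1 : HasDerivAt (fun x : ℝ => α * x + β) α p.1 := by
        simpa using ((hasDerivAt_id p.1).const_mul α).add_const β
      have n2 : HasDerivAt (fun x : ℝ => γ * x + δ) γ p.1 := by
        simpa using ((hasDerivAt_id p.1).const_mul γ).add_const δ
      refine (n1.div n2 (h1 p hp)).congr_deriv ?_
      simp only [u']; congr 1; ring
    have d2 : HasDerivAt (fun y : ℝ => (δ * y - γ) / (α - β * y)) (v' p) p.2 := by
      have n1 : HasDerivAt (fun x : ℝ => δ * x - γ) δ p.2 := by
        simpa using ((hasDerivAt_id p.2).const_mul δ).sub_const γ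
      have n2 : HasDerivAt (fun x : ℝ => α - β * x) (-β) p.2 := by
        simpa using ((hasDerivAt_id p.2).const_mul β).const_sub α
      refine (n1.div n2 (h2 p hp)).congr_deriv ?_
      simp only [v']; congr 1; ring
    exact HasFDerivAt.prodMap p d1.hasFDerivAt d2.hasFDerivAt
  refine ⟨measurable_image_of_fderivWithin hs hder hinj, ?_⟩
  rw [lintegral_image_eq_lintegral_abs_det_fderiv_mul volume hs hder hinj]
  apply setLIntegral_congr_fun hs
  intro p hp
  have a1 := h1 _ hp
  have a2 := h2 _ hp
  have hdet : (f' p).det = u' p * v' p := by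
    have : (f' p).det = LinearMap.det (LinearMap.prodMap
      (ContinuousLinearMap.toSpanSingleton ℝ (u' p)).toLinearMap
      (ContinuousLinearMap.toSpanSingleton ℝ (v' p)).toLinearMap) := rfl
    rw [this, LinearMap.det_prodMap, LinearMap.det_ring, LinearMap.det_ring]
    simp
  simp only [gden]
  rw [hdet, ← ENNReal.ofReal_mul (abs_nonneg _)]
  congr 1
  have hpos : 0 ≤ u' p * v' p := by
    have : u' p * v' p = ((α * δ - β * γ) / ((γ * p.1 + δ) * (α - β * p.2))) ^ 2 := by
      simp only [u', v']; field_simp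
    rw [this]; positivity
  rw [abs_of_nonneg hpos]
  have hk : 1 + (Phi α β γ δ p).1 * (Phi α β γ δ p).2 =
      (α * δ - β * γ) * (1 + p.1 * p.2) / ((γ * p.1 + δ) * (α - β * p.2)) := by
    simp only [Phi]
    rw [div_mul_div_comm, eq_div_iff (mul_ne_zero a1 a2), add_mul,
      div_mul_cancel₀ _ (mul_ne_zero a1 a2)]
    ring
  rw [hk]
  simp only [u', v']
  by_cases hz : 1 + p.1 * p.2 = 0
  · simp [hz]
  by_cases hl : Real.log (2 + Real.sqrt 3) = 0
  · simp [hl]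
  field_simp

theorem mubar_apply (s : Set (ℝ × ℝ)) (hs : MeasurableSet s)
    (h : s ⊆ (Set.Icc (0 : ℝ) 1) ×ˢ (Set.Icc (Real.sqrt 3 - 2) (Real.sqrt 3))) :
    mubar s = ∫⁻ p in s, gden p := by
  rw [mubar, withDensity_apply _ hs, Measure.restrict_restrict hs, inter_eq_left.mpr h]
  rfl

theorem sqrt3_facts : (Real.sqrt 3) ^ 2 = 3 ∧ 1.73 < Real.sqrt 3 ∧ Real.sqrt 3 < 1.74 := by
  refine ⟨by norm_num, Real.lt_sqrt_of_sq_lt (by norm_num), ?_⟩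
  rw [Real.sqrt_lt' (by norm_num)]; norm_num

theorem mubar_prob : IsProbabilityMeasure mubar := by
  obtain ⟨q, q1, q2⟩ := sqrt3_facts
  set r := Real.sqrt 3 with hr
  have hL : 0 < Real.log (2 + r) := Real.log_pos (by linarith)
  constructor
  have hg : Measurable gden := by unfold gden; fun_prop
  have inner : ∀ x ∈ Icc (0:ℝ) 1, ∫⁻ y in Icc (r - 2) r, gden (x, y) =
      ENNReal.ofReal (2 / (Real.log (2 + r) * ((1 - (2 - r) * x) * (1 + r * x)))) := by
    intro x hx
    have hpos : ∀ y ∈ Icc (r - 2) r, 0 < 1 + x * y := by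
      intro y hy; nlinarith [hx.1, hx.2, hy.1, hy.2]
    have hc : ContinuousOn (fun y : ℝ => 1 / (Real.log (2 + r) * (1 + x * y) ^ 2))
        (Icc (r - 2) r) := by
      apply ContinuousOn.div (by fun_prop) (by fun_prop)
      intro y hy; have := hpos y hy; positivity
    have key : ∫ y in (r - 2)..r, 1 / (Real.log (2 + r) * (1 + x * y) ^ 2) =
        r / (Real.log (2 + r) * (1 + x * r)) -
          (r - 2) / (Real.log (2 + r) * (1 + x * (r - 2))) := by
      apply intervalIntegral.integral_eq_sub_of_hasDerivAt
        (f := fun y => y / (Real.log (2 + r) * (1 + x * y)))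
      · intro y hy
        rw [uIcc_of_le (by linarith)] at hy
        have hp := hpos y hy
        have n2 : HasDerivAt (fun y : ℝ => Real.log (2 + r) * (1 + x * y))
            (Real.log (2 + r) * x) y := by
          simpa using (((hasDerivAt_id y).const_mul x).const_add 1).const_mul (Real.log (2 + r))
        refine ((hasDerivAt_id y).div n2 (by positivity)).congr_deriv ?_
        simp only [id]
        rw [div_eq_div_iff (by positivity) (by positivity)]
        ring
      · apply ContinuousOn.intervalIntegrable
        rwa [uIcc_of_le (by linarith)]
    simp only [gden, ← hr]
    rw [← ofReal_integral_eq_lintegral_ofReal (hc.integrableOn_Icc)]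
    · rw [integral_Icc_eq_integral_Ioc, ← intervalIntegral.integral_of_le (by linarith), key]
      congr 1
      have e1 := hpos r ⟨by linarith, le_rfl⟩
      have e2 := hpos (r - 2) ⟨le_rfl, by linarith⟩
      have e3 : 0 < 1 - (2 - r) * x := by linarith
      have e4 : 0 < 1 + r * x := by linarith
      rw [show 1 + x * (r - 2) = 1 - (2 - r) * x by ring, show 1 + x * r = 1 + r * x by ring]
      rw [div_sub_div _ _ (by positivity) (by positivity),
        div_eq_div_iff (by positivity) (by positivity)]
      ring
    · filter_upwards with y
      positivity
  have tot : mubar univ = ∫⁻ x in Icc (0:ℝ) 1, ∫⁻ y in Icc (r - 2) r, gden (x, y) := by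
    change (Measure.withDensity _ gden) univ = _
    rw [withDensity_apply _ MeasurableSet.univ, Measure.restrict_univ,
      Measure.volume_eq_prod, ← Measure.prod_restrict, lintegral_prod _ hg.aemeasurable]
  rw [tot, setLIntegral_congr_fun measurableSet_Icc inner]
  have p1 : ∀ x ∈ Icc (0:ℝ) 1, 0 < 1 - (2 - r) * x := by
    intro x hx; nlinarith [hx.1, hx.2]
  have p2 : ∀ x ∈ Icc (0:ℝ) 1, 0 < 1 + r * x := by
    intro x hx; nlinarith [hx.1, hx.2]
  have hc : ContinuousOn
      (fun x : ℝ => 2 / (Real.log (2 + r) * ((1 - (2 - r) * x) * (1 + r * x)))) (Icc 0 1) := by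
    apply ContinuousOn.div (by fun_prop) (by fun_prop)
    intro y hy; have := p1 y hy; have := p2 y hy; positivity
  rw [← ofReal_integral_eq_lintegral_ofReal hc.integrableOn_Icc]
  · rw [integral_Icc_eq_integral_Ioc, ← intervalIntegral.integral_of_le (by linarith)]
    rw [intervalIntegral.integral_eq_sub_of_hasDerivAt
      (f := fun x => (Real.log (1 + r * x) - Real.log (1 - (2 - r) * x)) / Real.log (2 + r))]
    · have : Real.log (1 + r * 1) - Real.log (1 - (2 - r) * 1) = Real.log (2 + r) := by
        rw [← Real.log_div (by linarith) (by linarith)]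
        congr 1
        rw [div_eq_iff (by linarith)]
        nlinarith
      rw [this]; simp [hL.ne']
    · intro x hx
      rw [uIcc_of_le (by linarith)] at hx
      have a1 := p1 x hx
      have a2 := p2 x hx
      have n1 : HasDerivAt (fun x : ℝ => 1 + r * x) r x := by
        simpa using ((hasDerivAt_id x).const_mul r).const_add 1
      have n2 : HasDerivAt (fun x : ℝ => 1 - (2 - r) * x) (-(2 - r)) x := by
        simpa using ((hasDerivAt_id x).const_mul (2 - r)).const_sub 1
      refine (((n1.log a2.ne').sub (n2.log a1.ne')).div_const (Real.log (2 + r))).congr_deriv ?_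
      rw [div_sub_div _ _ a2.ne' a1.ne', div_div, div_eq_div_iff (by positivity) (by positivity)]
      ring
    · apply ContinuousOn.intervalIntegrable
      rwa [uIcc_of_le (by linarith)]
  · filter_upwards [ae_restrict_mem measurableSet_Icc] with y hy
    have := p1 y hy; have := p2 y hy
    simp only [Pi.zero_apply]; positivity

theorem Te_plus (k : ℤ) (y : ℝ) (h1 : 2 * (k : ℝ) ≤ 1 / y) (h2 : 1 / y ≤ 2 * k + 1) :
    Te y = 1 / y - 2 * k := by
  unfold Te
  rcases h2.lt_or_eq with h | h
  · have : ⌊(1 / y + 1) / 2⌋ = k := by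
      rw [Int.floor_eq_iff]; constructor <;> linarith
    rw [this, abs_of_nonneg (by linarith)]
  · have : ⌊(1 / y + 1) / 2⌋ = k + 1 := by
      rw [Int.floor_eq_iff]; push_cast; constructor <;> linarith
    rw [this, h]; push_cast
    rw [abs_of_nonpos (by linarith)]; ring

theorem Te_minus (k : ℤ) (y : ℝ) (h1 : 2 * (k : ℝ) - 1 ≤ 1 / y) (h2 : 1 / y ≤ 2 * k) :
    Te y = 2 * k - 1 / y := by
  unfold Te
  have : ⌊(1 / y + 1) / 2⌋ = k := by
    rw [Int.floor_eq_iff]; constructor <;> linarith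
  rw [this, abs_of_nonpos (by linarith)]; ring

/-- Case description of a valid digit. -/
theorem valid_cases (d : Digit) (hd : d.Valid) :
    ∃ k : ℤ, (1 ≤ k ∧ d = ⟨k, 1, Par.e⟩) ∨ (2 ≤ k ∧ d = ⟨k, -1, Par.e⟩) ∨
      (2 ≤ k ∧ d = ⟨k, 1, Par.o⟩) ∨ (2 ≤ k ∧ d = ⟨k, -1, Par.o⟩) := by
  obtain ⟨k, e, s⟩ := d
  refine ⟨k, ?_⟩
  rcases hd with ⟨h1, h2⟩ | ⟨h1, h2, h3⟩
  · simp only at h1 h2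
    rcases h2 with rfl | rfl <;> cases s <;> simp [h1]
    omega
  · simp only at h1 h2 h3
    subst h1 h2 h3; simp

theorem branch_ep (k : ℤ) (hk : 1 ≤ k) (x : ℝ) (hx : x ∈ branch ⟨k, 1, Par.e⟩) :
    0 < x ∧ 2 * (k : ℝ) * x ≤ 1 ∧ 1 ≤ (2 * k + 1) * x := by
  have hk' : (1 : ℝ) ≤ k := by exact_mod_cast hk
  simp only [branch] at hx
  split_ifs at hx with h
  · subst h
    simp only [mem_Icc] at hx
    push_cast
    refine ⟨?_, ?_, ?_⟩ <;> linarith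
  · obtain ⟨h1, h2⟩ := hx
    rw [div_le_iff₀ (by linarith)] at h1
    rw [lt_div_iff₀ (by linarith)] at h2
    refine ⟨?_, ?_, ?_⟩ <;> nlinarith

theorem branch_em (k : ℤ) (hk : 2 ≤ k) (x : ℝ) (hx : x ∈ branch ⟨k, -1, Par.e⟩) :
    0 < x ∧ (2 * (k : ℝ) - 1) * x ≤ 1 ∧ 1 ≤ (2 * k) * x := by
  have hk' : (2 : ℝ) ≤ k := by exact_mod_cast hk
  have h0 : k ≠ 1 := by omega
  simp [branch, h0] at hx
  obtain ⟨h1, h2⟩ := hx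
  rw [← mul_inv, inv_le_iff_one_le_mul₀ (by linarith)] at h1
  rw [lt_inv_comm₀ (by nlinarith) (by linarith), ← one_div, lt_div_iff₀ (by nlinarith)] at h2
  refine ⟨?_, ?_, ?_⟩ <;> nlinarith

theorem branch_op (k : ℤ) (hk : 2 ≤ k) (x : ℝ) (hx : x ∈ branch ⟨k, 1, Par.o⟩) :
    2 * (k : ℝ) - 1 < (2 * k + 1) * x ∧ (k + 1) * x ≤ k := by
  have hk' : (2 : ℝ) ≤ k := by exact_mod_cast hk
  simp only [branch, if_true] at hx
  obtain ⟨h1, h2⟩ := hx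
  rw [div_lt_iff₀ (by linarith)] at h1
  rw [le_div_iff₀ (by linarith)] at h2
  constructor <;> linarith

theorem branch_om (k : ℤ) (hk : 2 ≤ k) (x : ℝ) (hx : x ∈ branch ⟨k, -1, Par.o⟩) :
    (k : ℝ) - 1 < k * x ∧ (2 * k + 1) * x ≤ 2 * (k : ℝ) - 1 := by
  have hk' : (2 : ℝ) ≤ k := by exact_mod_cast hk
  have hx' : x ∈ Set.Ioc (((k : ℝ) - 1) / (k : ℝ)) ((2 * (k : ℝ) - 1) / (2 * (k : ℝ) + 1)) := by
    simpa [branch] using hx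
  obtain ⟨h1, h2⟩ := hx'
  rw [div_lt_iff₀ (by linarith)] at h1
  rw [le_div_iff₀ (by linarith)] at h2
  constructor <;> linarith

theorem branch_meas (d : Digit) : MeasurableSet (branch d) := by
  obtain ⟨k, e, s⟩ := d
  cases s <;> simp only [branch] <;> split_ifs <;> measurability

theorem exists_digit (x : ℝ) (h0 : 0 < x) (h1 : x < 1) :
    ∃ d : Digit, d.Valid ∧ x ∈ branch d := by
  by_cases hx : x ≤ 1 / 2
  · set n := ⌈1 / x⌉ with hn
    have a1 : 1 / x ≤ n := Int.le_ceil _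
    have a2 : (n : ℝ) < 1 / x + 1 := Int.ceil_lt_add_one _
    have a3 : 2 ≤ 1 / x := by rw [le_div_iff₀ h0]; linarith
    have a4 : (2 : ℝ) ≤ n := a3.trans a1
    have a5 : 2 ≤ n := by exact_mod_cast a4
    have b1 : 1 ≤ n * x := by rwa [div_le_iff₀ h0] at a1
    have b2 : (n - 1) * x < 1 := by
      have : (n : ℝ) - 1 < 1 / x := by linarith
      rwa [lt_div_iff₀ h0] at this
    rcases Int.even_or_odd' n with ⟨k, hk | hk⟩
    · have hk' : (n : ℝ) = 2 * k := by rw [hk]; push_cast; ring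
      rw [hk'] at b1 b2
      by_cases hk1 : k = 1
      · subst hk1
        refine ⟨⟨1, 1, Par.e⟩, Or.inr ⟨rfl, rfl, rfl⟩, ?_⟩
        simp only [branch, if_true, mem_Icc]
        push_cast at b1
        constructor <;> linarith
      · have hk2 : 2 ≤ k := by omega
        have hk3 : (2 : ℝ) ≤ k := by exact_mod_cast hk2
        refine ⟨⟨k, -1, Par.e⟩, Or.inl ⟨hk2, Or.inr rfl⟩, ?_⟩
        have : x ∈ Set.Ico (1 / (2 * (k : ℝ))) (1 / (2 * (k : ℝ) - 1)) := by
          constructor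
          · rw [div_le_iff₀ (by linarith)]; linarith
          · rw [lt_div_iff₀ (by linarith)]; linarith
        simpa [branch, hk1] using this
    · have hk' : (n : ℝ) = 2 * k + 1 := by rw [hk]; push_cast; ring
      rw [hk'] at b1 b2
      by_cases hk1 : k = 1
      · subst hk1
        refine ⟨⟨1, 1, Par.e⟩, Or.inr ⟨rfl, rfl, rfl⟩, ?_⟩
        simp only [branch, if_true, mem_Icc]
        push_cast at b1
        constructor <;> linarith
      · have hk2 : 2 ≤ k := by omega
        have hk3 : (2 : ℝ) ≤ k := by exact_mod_cast hk2
        refine ⟨⟨k, 1, Par.e⟩, Or.inl ⟨hk2, Or.inl rfl⟩, ?_⟩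
        simp only [branch, if_neg hk1, if_true]
        constructor
        · rw [div_le_iff₀ (by linarith)]; linarith
        · rw [lt_div_iff₀ (by linarith)]; linarith
  · push Not at hx
    have hy : 0 < 1 - x := by linarith
    set n := ⌈2 / (1 - x)⌉ with hn
    have a1 : 2 / (1 - x) ≤ n := Int.le_ceil _
    have a2 : (n : ℝ) < 2 / (1 - x) + 1 := Int.ceil_lt_add_one _
    have a3 : 4 < 2 / (1 - x) := by rw [lt_div_iff₀ hy]; linarith
    have a4 : (4 : ℝ) < n := a3.trans_le a1
    have a5 : 4 < n := by exact_mod_cast a4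
    have b1 : 2 ≤ n * (1 - x) := by rwa [div_le_iff₀ hy] at a1
    have b2 : (n - 1) * (1 - x) < 2 := by
      have : (n : ℝ) - 1 < 2 / (1 - x) := by linarith
      rwa [lt_div_iff₀ hy] at this
    rcases Int.even_or_odd' n with ⟨j, hk | hk⟩
    · obtain ⟨k, rfl⟩ : ∃ k, j = k + 1 := ⟨j - 1, by ring⟩
      have hk' : (n : ℝ) = 2 * k + 2 := by rw [hk]; push_cast; ring
      rw [hk'] at b1 b2
      have hk2 : 2 ≤ k := by omega
      have hk3 : (2 : ℝ) ≤ k := by exact_mod_cast hk2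
      refine ⟨⟨k, 1, Par.o⟩, Or.inl ⟨hk2, Or.inl rfl⟩, ?_⟩
      simp only [branch, if_true]
      constructor
      · rw [div_lt_iff₀ (by linarith)]; linarith
      · rw [le_div_iff₀ (by linarith)]; linarith
    · obtain ⟨k, rfl⟩ : ∃ k, j = k := ⟨j, rfl⟩
      have hk' : (n : ℝ) = 2 * j + 1 := by rw [hk]; push_cast; ring
      rw [hk'] at b1 b2
      have hk2 : 2 ≤ j := by omega
      have hk3 : (2 : ℝ) ≤ j := by exact_mod_cast hk2
      refine ⟨⟨j, -1, Par.o⟩, Or.inl ⟨hk2, Or.inr rfl⟩, ?_⟩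
      have : x ∈ Set.Ioc (((j : ℝ) - 1) / (j : ℝ)) ((2 * (j : ℝ) - 1) / (2 * (j : ℝ) + 1)) := by
        constructor
        · rw [div_lt_iff₀ (by linarith)]; linarith
        · rw [le_div_iff₀ (by linarith)]; linarith
      simpa [branch] using this

/-- Location of the dual branches. -/
theorem hbar_ep (k : ℤ) (y : ℝ) : hbar ⟨k, 1, Par.e⟩ y = 1 / (2 * k + y) := by
  simp [hbar]

theorem hbar_em (k : ℤ) (y : ℝ) : hbar ⟨k, -1, Par.e⟩ y = -(1 / (2 * k + y)) := by
  simp [hbar]; ring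

theorem hbar_op (k : ℤ) (y : ℝ) :
    hbar ⟨k, 1, Par.o⟩ y = 1 / (1 + 1 / (k - 1 + 1 / (1 + y))) := by
  simp [hbar]

theorem hbar_om (k : ℤ) (y : ℝ) :
    hbar ⟨k, -1, Par.o⟩ y = 1 / (1 - 1 / (k + 1 / (1 + y))) := by
  simp [hbar]; ring

theorem dual_bounds (y : ℝ) (hy : y ∈ Ioo (Real.sqrt 3 - 2) (Real.sqrt 3)) :
    (Real.sqrt 3 - 1) / 2 < 1 / (1 + y) ∧ 1 / (1 + y) < (Real.sqrt 3 + 1) / 2 := by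
  obtain ⟨q, q1, q2⟩ := sqrt3_facts
  obtain ⟨h1, h2⟩ := hy
  constructor
  · rw [lt_div_iff₀ (by linarith)]; nlinarith
  · rw [div_lt_iff₀ (by linarith)]; nlinarith

theorem loc_ep (k : ℤ) (hk : 1 ≤ k) (y : ℝ) (hy : y ∈ Ioo (Real.sqrt 3 - 2) (Real.sqrt 3)) :
    0 < hbar ⟨k, 1, Par.e⟩ y ∧ hbar ⟨k, 1, Par.e⟩ y < Real.sqrt 3 / 3 := by
  obtain ⟨q, q1, q2⟩ := sqrt3_facts
  obtain ⟨h1, h2⟩ := hy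
  have hk' : (1 : ℝ) ≤ k := by exact_mod_cast hk
  have : 0 < 2 * (k : ℝ) + y := by linarith
  rw [hbar_ep]
  refine ⟨by positivity, ?_⟩
  rw [div_lt_iff₀ this]; nlinarith

theorem loc_em (k : ℤ) (hk : 2 ≤ k) (y : ℝ) (hy : y ∈ Ioo (Real.sqrt 3 - 2) (Real.sqrt 3)) :
    Real.sqrt 3 - 2 < hbar ⟨k, -1, Par.e⟩ y ∧ hbar ⟨k, -1, Par.e⟩ y < 0 := by
  obtain ⟨q, q1, q2⟩ := sqrt3_facts
  obtain ⟨h1, h2⟩ := hy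
  have hk' : (2 : ℝ) ≤ k := by exact_mod_cast hk
  have h3 : 0 < 2 * (k : ℝ) + y := by linarith
  rw [hbar_em]
  have : 1 / (2 * (k : ℝ) + y) < 2 - Real.sqrt 3 := by
    rw [div_lt_iff₀ h3]; nlinarith
  have : 0 < 1 / (2 * (k : ℝ) + y) := by positivity
  constructor <;> linarith

theorem loc_op (k : ℤ) (hk : 2 ≤ k) (y : ℝ) (hy : y ∈ Ioo (Real.sqrt 3 - 2) (Real.sqrt 3)) :
    Real.sqrt 3 / 3 < hbar ⟨k, 1, Par.o⟩ y ∧ hbar ⟨k, 1, Par.o⟩ y < 1 := by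
  obtain ⟨q, q1, q2⟩ := sqrt3_facts
  obtain ⟨h1, h2⟩ := dual_bounds y hy
  have hk' : (2 : ℝ) ≤ k := by exact_mod_cast hk
  rw [hbar_op]
  generalize hw : (k : ℝ) - 1 + 1 / (1 + y) = w
  have hw1 : (Real.sqrt 3 + 1) / 2 < w := by linarith
  have hw0 : 0 < w := by linarith
  have e : 1 / (1 + 1 / w) = w / (w + 1) := by field_simp
  rw [e]
  constructor
  · rw [lt_div_iff₀ (by linarith)]; nlinarith
  · rw [div_lt_iff₀ (by linarith)]; linarith

theorem loc_om (k : ℤ) (hk : 2 ≤ k) (y : ℝ) (hy : y ∈ Ioo (Real.sqrt 3 - 2) (Real.sqrt 3)) :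
    1 < hbar ⟨k, -1, Par.o⟩ y ∧ hbar ⟨k, -1, Par.o⟩ y < Real.sqrt 3 := by
  obtain ⟨q, q1, q2⟩ := sqrt3_facts
  obtain ⟨h1, h2⟩ := dual_bounds y hy
  have hk' : (2 : ℝ) ≤ k := by exact_mod_cast hk
  rw [hbar_om]
  generalize hw : (k : ℝ) + 1 / (1 + y) = w
  have hw1 : (Real.sqrt 3 + 3) / 2 < w := by linarith
  have hw0 : 0 < w := by linarith
  have hw2 : 0 < w - 1 := by linarith
  have e : 1 / (1 - 1 / w) = w / (w - 1) := by field_simp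
  rw [e]
  constructor
  · rw [lt_div_iff₀ (by linarith)]; linarith
  · rw [div_lt_iff₀ (by linarith)]; nlinarith

theorem int_eq_of_abs (k k' : ℤ) (h1 : (k : ℝ) - k' < 1) (h2 : (k' : ℝ) - k < 1) : k = k' := by
  have h1' : k - k' < 1 := by exact_mod_cast h1
  have h2' : k' - k < 1 := by exact_mod_cast h2
  omega

theorem hbar_inj (d d' : Digit) (hd : d.Valid) (hd' : d'.Valid) (y y' : ℝ)
    (hy : y ∈ Ioo (Real.sqrt 3 - 2) (Real.sqrt 3)) (hy' : y' ∈ Ioo (Real.sqrt 3 - 2) (Real.sqrt 3))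
    (he : hbar d y = hbar d' y') : d = d' := by
  obtain ⟨q, q1, q2⟩ := sqrt3_facts
  have i1 := dual_bounds y hy
  have i2 := dual_bounds y' hy'
  have j1 := hy.1
  have j2 := hy.2
  have j3 := hy'.1
  have j4 := hy'.2
  obtain ⟨k, hk⟩ := valid_cases d hd
  obtain ⟨k', hk'⟩ := valid_cases d' hd'
  rcases hk with ⟨hk, rfl⟩ | ⟨hk, rfl⟩ | ⟨hk, rfl⟩ | ⟨hk, rfl⟩ <;>
  rcases hk' with ⟨hk', rfl⟩ | ⟨hk', rfl⟩ | ⟨hk', rfl⟩ | ⟨hk', rfl⟩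
  · rw [hbar_ep, hbar_ep, one_div, one_div, inv_inj] at he
    rw [int_eq_of_abs k k' (by linarith) (by linarith)]
  · linarith [loc_ep k hk y hy, loc_em k' hk' y' hy']
  · linarith [loc_ep k hk y hy, loc_op k' hk' y' hy']
  · linarith [loc_ep k hk y hy, loc_om k' hk' y' hy']
  · linarith [loc_em k hk y hy, loc_ep k' hk' y' hy']
  · rw [hbar_em, hbar_em, neg_inj, one_div, one_div, inv_inj] at he
    rw [int_eq_of_abs k k' (by linarith) (by linarith)]
  · linarith [loc_em k hk y hy, loc_op k' hk' y' hy']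
  · linarith [loc_em k hk y hy, loc_om k' hk' y' hy']
  · linarith [loc_op k hk y hy, loc_ep k' hk' y' hy']
  · linarith [loc_op k hk y hy, loc_em k' hk' y' hy']
  · rw [hbar_op, hbar_op] at he
    simp only [one_div, inv_inj, add_right_inj] at he i1 i2
    rw [int_eq_of_abs k k' (by linarith) (by linarith)]
  · linarith [loc_op k hk y hy, loc_om k' hk' y' hy']
  · linarith [loc_om k hk y hy, loc_ep k' hk' y' hy']
  · linarith [loc_om k hk y hy, loc_em k' hk' y' hy']
  · linarith [loc_om k hk y hy, loc_op k' hk' y' hy']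
  · rw [hbar_om, hbar_om] at he
    simp only [one_div, inv_inj, sub_right_inj] at he i1 i2
    rw [int_eq_of_abs k k' (by linarith) (by linarith)]

theorem hbar_mem (d : Digit) (hd : d.Valid) (y : ℝ)
    (hy : y ∈ Ioo (Real.sqrt 3 - 2) (Real.sqrt 3)) :
    hbar d y ∈ Icc (Real.sqrt 3 - 2) (Real.sqrt 3) := by
  obtain ⟨q, q1, q2⟩ := sqrt3_facts
  obtain ⟨k, hk⟩ := valid_cases d hd
  rcases hk with ⟨hk, rfl⟩ | ⟨hk, rfl⟩ | ⟨hk, rfl⟩ | ⟨hk, rfl⟩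
  · obtain ⟨h1, h2⟩ := loc_ep k hk y hy
    constructor <;> linarith
  · obtain ⟨h1, h2⟩ := loc_em k hk y hy
    constructor <;> linarith
  · obtain ⟨h1, h2⟩ := loc_op k hk y hy
    constructor <;> linarith
  · obtain ⟨h1, h2⟩ := loc_om k hk y hy
    constructor <;> linarith

theorem T_half (x : ℝ) (h0 : 0 < x) (h1 : x ≤ 1 / 2) : T x = Te x := by
  unfold T
  rw [if_neg (by linarith), if_neg (by linarith), if_pos h1]

theorem T_upper (x : ℝ) (h0 : 1 / 2 < x) (h1 : x < 1) : T x = iota (Te (iota x)) := by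
  unfold T
  rw [if_neg (by linarith), if_neg (by linarith), if_neg (by linarith)]

theorem digit_data (d : Digit) (hd : d.Valid) : ∃ α β γ δ : ℝ, α * δ - β * γ ≠ 0 ∧
    (∀ x ∈ branch d, γ * x + δ ≠ 0 ∧ T x = (α * x + β) / (γ * x + δ) ∧ T x ∈ Icc (0 : ℝ) 1 ∧
      x ∈ Icc (0 : ℝ) 1) ∧
    (∀ y ∈ Ioo (Real.sqrt 3 - 2) (Real.sqrt 3), α - β * y ≠ 0 ∧
      hbar d y = (δ * y - γ) / (α - β * y)) := by
  obtain ⟨q, q1, q2⟩ := sqrt3_facts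
  obtain ⟨k, hk⟩ := valid_cases d hd
  rcases hk with ⟨hk, rfl⟩ | ⟨hk, rfl⟩ | ⟨hk, rfl⟩ | ⟨hk, rfl⟩
  · have hk' : (1 : ℝ) ≤ k := by exact_mod_cast hk
    refine ⟨-2 * k, 1, 1, 0, by norm_num, ?_, ?_⟩
    · intro x hx
      obtain ⟨h0, h1, h2⟩ := branch_ep k hk x hx
      have c1 : 2 * (k : ℝ) ≤ 1 / x := by rw [le_div_iff₀ h0]; linarith
      have c2 : 1 / x ≤ 2 * k + 1 := by rw [div_le_iff₀ h0]; linarith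
      have hh : x ≤ 1 / 2 := by nlinarith
      rw [T_half x h0 hh, Te_plus k x c1 c2]
      refine ⟨by linarith, ?_, ⟨by linarith, by linarith⟩, ⟨by linarith, by linarith⟩⟩
      field_simp; ring
    · intro y hy
      have : 0 < 2 * (k : ℝ) + y := by linarith [hy.1]
      have h' : -2 * (k : ℝ) - 1 * y ≠ 0 := by linarith
      refine ⟨h', ?_⟩
      rw [hbar_ep, div_eq_div_iff this.ne' h']; ring
  · have hk' : (2 : ℝ) ≤ k := by exact_mod_cast hk
    refine ⟨2 * k, -1, 1, 0, by norm_num, ?_, ?_⟩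
    · intro x hx
      obtain ⟨h0, h1, h2⟩ := branch_em k hk x hx
      have c1 : 2 * (k : ℝ) - 1 ≤ 1 / x := by rw [le_div_iff₀ h0]; linarith
      have c2 : 1 / x ≤ 2 * k := by rw [div_le_iff₀ h0]; linarith
      have hh : x ≤ 1 / 2 := by nlinarith
      rw [T_half x h0 hh, Te_minus k x c1 c2]
      refine ⟨by linarith, ?_, ⟨by linarith, by linarith⟩, ⟨by linarith, by linarith⟩⟩
      field_simp; ring
    · intro y hy
      have : 0 < 2 * (k : ℝ) + y := by linarith [hy.1]
      have h' : 2 * (k : ℝ) - (-1) * y ≠ 0 := by linarith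
      refine ⟨h', ?_⟩
      rw [hbar_em, ← neg_div, div_eq_div_iff this.ne' h']; ring
  · have hk' : (2 : ℝ) ≤ k := by exact_mod_cast hk
    refine ⟨-(k + 1), k, k, -(k - 1), by ring_nf; norm_num, ?_, ?_⟩
    · intro x hx
      obtain ⟨h1, h2⟩ := branch_op k hk x hx
      have hx1 : x < 1 := by nlinarith
      have hx0 : 1 / 2 < x := by nlinarith
      have hp : 0 < (k : ℝ) * x + -(k - 1) := by nlinarith
      have ei : 1 / iota x = (1 + x) / (1 - x) := by unfold iota; rw [one_div_div]
      have c1 : 2 * (k : ℝ) ≤ 1 / iota x := by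
        rw [ei, le_div_iff₀ (by linarith)]; linarith
      have c2 : 1 / iota x ≤ 2 * k + 1 := by
        rw [ei, div_le_iff₀ (by linarith)]; linarith
      have eT : T x = (-(k + 1) * x + k) / (k * x + -(k - 1)) := by
        rw [T_upper x hx0 hx1, Te_plus k _ c1 c2, ei]
        unfold iota
        have e1 : 1 - ((1 + x) / (1 - x) - 2 * (k : ℝ)) =
          2 * (-(k + 1) * x + k) / (1 - x) := by
          rw [eq_div_iff (by linarith), sub_mul, sub_mul, div_mul_cancel₀ _ (by linarith)]; ring
        have e2 : 1 + ((1 + x) / (1 - x) - 2 * (k : ℝ)) =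
          2 * (k * x + -(k - 1)) / (1 - x) := by
          rw [eq_div_iff (by linarith), add_mul, sub_mul, div_mul_cancel₀ _ (by linarith)]; ring
        rw [e1, e2, div_div_div_cancel_right₀ (by linarith), mul_div_mul_left _ _ (by norm_num)]
      refine ⟨hp.ne', eT, ?_, ⟨by linarith, by linarith⟩⟩
      rw [eT]
      constructor
      · apply div_nonneg <;> linarith
      · rw [div_le_one hp]; linarith
    · intro y hy
      have y1 : 0 < 1 + y := by linarith [hy.1]
      have n1 : 0 < (k : ℝ) * y + k + 1 := by nlinarith
      have n2 : 0 < ((k : ℝ) - 1) * y + k := by nlinarith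
      have h' : -((k : ℝ) + 1) - k * y ≠ 0 := by linarith
      refine ⟨h', ?_⟩
      rw [hbar_op]
      have e1 : (k : ℝ) - 1 + 1 / (1 + y) = ((k - 1) * y + k) / (1 + y) := by
        rw [eq_div_iff y1.ne', add_mul, div_mul_cancel₀ _ y1.ne']; ring
      have e2 : 1 + (1 + y) / (((k : ℝ) - 1) * y + k) = (k * y + k + 1) / ((k - 1) * y + k) := by
        rw [eq_div_iff n2.ne', add_mul, div_mul_cancel₀ _ n2.ne']; ring
      rw [e1, one_div_div, e2, one_div_div, div_eq_div_iff n1.ne' h']; ring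
  · have hk' : (2 : ℝ) ≤ k := by exact_mod_cast hk
    refine ⟨k, -(k - 1), -(k + 1), k, by ring_nf; norm_num, ?_, ?_⟩
    · intro x hx
      obtain ⟨h1, h2⟩ := branch_om k hk x hx
      have hx1 : x < 1 := by nlinarith
      have hx0 : 1 / 2 < x := by nlinarith
      have hp : 0 < -((k : ℝ) + 1) * x + k := by nlinarith
      have ei : 1 / iota x = (1 + x) / (1 - x) := by unfold iota; rw [one_div_div]
      have c1 : 2 * (k : ℝ) - 1 ≤ 1 / iota x := by
        rw [ei, le_div_iff₀ (by linarith)]; linarith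
      have c2 : 1 / iota x ≤ 2 * k := by
        rw [ei, div_le_iff₀ (by linarith)]; linarith
      have eT : T x = (k * x + -(k - 1)) / (-(k + 1) * x + k) := by
        rw [T_upper x hx0 hx1, Te_minus k _ c1 c2, ei]
        unfold iota
        have e1 : 1 + (2 * (k : ℝ) - (1 + x) / (1 - x)) =
          2 * (-(k + 1) * x + k) / (1 - x) := by
          rw [eq_div_iff (by linarith), add_mul, sub_mul, div_mul_cancel₀ _ (by linarith)]; ring
        have e2 : 1 - (2 * (k : ℝ) - (1 + x) / (1 - x)) =
          2 * (k * x + -(k - 1)) / (1 - x) := by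
          rw [eq_div_iff (by linarith), sub_mul, sub_mul, div_mul_cancel₀ _ (by linarith)]; ring
        rw [e1, e2, div_div_div_cancel_right₀ (by linarith), mul_div_mul_left _ _ (by norm_num)]
      refine ⟨hp.ne', eT, ?_, ⟨by linarith, by linarith⟩⟩
      rw [eT]
      constructor
      · apply div_nonneg <;> linarith
      · rw [div_le_one hp]; linarith
    · intro y hy
      have y1 : 0 < 1 + y := by linarith [hy.1]
      have n1 : 0 < (k : ℝ) * y + k + 1 := by nlinarith
      have n2 : 0 < ((k : ℝ) - 1) * y + k := by nlinarith
      have h' : (k : ℝ) - -(k - 1) * y ≠ 0 := by linarith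
      refine ⟨h', ?_⟩
      rw [hbar_om]
      have e1 : (k : ℝ) + 1 / (1 + y) = (k * y + k + 1) / (1 + y) := by
        rw [eq_div_iff y1.ne', add_mul, div_mul_cancel₀ _ y1.ne']; ring
      have e2 : 1 - (1 + y) / ((k : ℝ) * y + k + 1) = ((k - 1) * y + k) / (k * y + k + 1) := by
        rw [eq_div_iff n1.ne', sub_mul, div_mul_cancel₀ _ n1.ne']; ring
      rw [e1, one_div_div, e2, one_div_div, div_eq_div_iff n2.ne' h']; ring

theorem digit_spec (x : ℝ) (h0 : 0 < x) (h1 : x < 1) :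
    (digit x).Valid ∧ x ∈ branch (digit x) := by
  have h := exists_digit x h0 h1
  unfold digit
  rw [dif_pos h]
  exact h.choose_spec

instance countable_digit : Countable Digit := by
  have : Function.Injective (fun d : Digit => (d.a, d.eps, decide (d.s = Par.e))) := by
    rintro ⟨a, b, c⟩ ⟨a', b', c'⟩ h
    cases c <;> cases c' <;> simp_all
  exact this.countable

theorem mubar_le (E : Set (ℝ × ℝ)) (hE : MeasurableSet E) :
    mubar (Tbar ⁻¹' E) ≤ mubar E := by
  choose! α β γ δ hD hx hy using digit_data
  let F : Digit → ℝ × ℝ → ℝ × ℝ := fun d => Phi (α d) (β d) (γ d) (δ d)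
  let S : {d : Digit // d.Valid} → Set (ℝ × ℝ) := fun d =>
    (branch d.1 ×ˢ Ioo (Real.sqrt 3 - 2) (Real.sqrt 3)) ∩ F d.1 ⁻¹' E
  have hF : ∀ d, Measurable (F d) := by
    intro d
    simp only [F]; unfold Phi; fun_prop
  have hS : ∀ d, MeasurableSet (S d) := fun d =>
    ((branch_meas d.1).prod measurableSet_Ioo).inter (hF d.1 hE)
  have hval : ∀ d : {d : Digit // d.Valid}, ∀ p ∈ S d, F d.1 p = (T p.1, hbar d.1 p.2) := by
    rintro d p ⟨⟨h1, h2⟩, -⟩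
    simp only [F, Phi]
    rw [(hx d.1 d.2 p.1 h1).2.1, (hy d.1 d.2 p.2 h2).2]
  have hstep : ∀ d : {d : Digit // d.Valid},
      MeasurableSet (F d.1 '' S d) ∧ mubar (S d) = mubar (F d.1 '' S d) := by
    intro d
    obtain ⟨m, e⟩ := lintegral_Phi (α d) (β d) (γ d) (δ d) (hD d.1 d.2) (S d) (hS d)
      (fun p hp => (hx d.1 d.2 p.1 hp.1.1).1) (fun p hp => (hy d.1 d.2 p.2 hp.1.2).1)
    refine ⟨m, ?_⟩
    rw [mubar_apply _ (hS d), mubar_apply _ m, e]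
    · rintro _ ⟨p, hp, rfl⟩
      change F d.1 p ∈ _
      rw [hval d p hp]
      exact ⟨(hx d.1 d.2 p.1 hp.1.1).2.2.1, hbar_mem d.1 d.2 p.2 hp.1.2⟩
    · rintro p hp
      exact ⟨(hx d.1 d.2 p.1 hp.1.1).2.2.2, Ioo_subset_Icc_self hp.1.2⟩
  have hae : (Tbar ⁻¹' E : Set (ℝ × ℝ)) ≤ᵐ[mubar] (⋃ d, S d : Set (ℝ × ℝ)) := by
    have hac : mubar ≪ (volume.restrict (Icc (0:ℝ) 1)).prod
        (volume.restrict (Icc (Real.sqrt 3 - 2) (Real.sqrt 3))) := by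
      rw [Measure.prod_restrict, ← Measure.volume_eq_prod]
      exact withDensity_absolutelyContinuous _ _
    apply hac.ae_le
    have A1 : ∀ᵐ x ∂(volume.restrict (Icc (0:ℝ) 1)), x ∈ Ioo (0:ℝ) 1 := by
      rw [← restrict_Ioo_eq_restrict_Icc]; exact ae_restrict_mem measurableSet_Ioo
    have A2 : ∀ᵐ y ∂(volume.restrict (Icc (Real.sqrt 3 - 2) (Real.sqrt 3))),
        y ∈ Ioo (Real.sqrt 3 - 2) (Real.sqrt 3) := by
      rw [← restrict_Ioo_eq_restrict_Icc]; exact ae_restrict_mem measurableSet_Ioo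
    have B1 := (Measure.quasiMeasurePreserving_fst (μ := volume.restrict (Icc (0:ℝ) 1))
      (ν := volume.restrict (Icc (Real.sqrt 3 - 2) (Real.sqrt 3)))).ae A1
    have B2 := (Measure.quasiMeasurePreserving_snd (μ := volume.restrict (Icc (0:ℝ) 1))
      (ν := volume.restrict (Icc (Real.sqrt 3 - 2) (Real.sqrt 3)))).ae A2
    filter_upwards [B1, B2] with p h1 h2 hp
    obtain ⟨v, b⟩ := digit_spec p.1 h1.1 h1.2
    refine mem_iUnion.mpr ⟨⟨digit p.1, v⟩, ⟨b, h2⟩, ?_⟩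
    have : F (digit p.1) p = Tbar p := by
      simp only [F, Phi, Tbar]
      rw [(hx _ v p.1 b).2.1, (hy _ v p.2 h2).2]
    change F (digit p.1) p ∈ E
    rw [this]; exact hp
  calc mubar (Tbar ⁻¹' E) ≤ mubar (⋃ d, S d) := measure_mono_ae hae
    _ ≤ ∑' d, mubar (S d) := measure_iUnion_le _
    _ = ∑' d : {d : Digit // d.Valid}, mubar (F d.1 '' S d) :=
        tsum_congr fun d => (hstep d).2
    _ = mubar (⋃ d : {d : Digit // d.Valid}, F d.1 '' S d) := by
        rw [measure_iUnion _ fun d => (hstep d).1]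
        intro d d' hne
        rw [Function.onFun, Set.disjoint_left]
        rintro _ ⟨p, hp, rfl⟩ ⟨p', hp', he⟩
        rw [hval d p hp, hval d' p' hp'] at he
        apply hne
        apply Subtype.ext
        exact hbar_inj d.1 d'.1 d.2 d'.2 p.2 p'.2 hp.1.2 hp'.1.2 (congrArg Prod.snd he).symm
    _ ≤ mubar E := by
        apply measure_mono
        apply iUnion_subset
        rintro d _ ⟨p, hp, rfl⟩
        exact hp.2

/-- `μ̄` is a probability measure invariant under the natural
extension `𝑇̄`. -/
theorem mubar_isProbability_and_Tbar_invariant :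
    IsProbabilityMeasure mubar ∧
      ∀ E : Set (ℝ × ℝ), MeasurableSet E → mubar (Tbar ⁻¹' E) = mubar E := by
  refine ⟨mubar_prob, fun E hE => ?_⟩
  have := mubar_prob
  apply le_antisymm (mubar_le E hE)
  have h2 := mubar_le Eᶜ hE.compl
  have h3 : mubar E + mubar Eᶜ ≤ mubar (Tbar ⁻¹' E) + mubar Eᶜ := by
    rw [measure_add_measure_compl hE]
    calc mubar univ = mubar (Tbar ⁻¹' E ∪ Tbar ⁻¹' Eᶜ) := by
          rw [preimage_compl, union_compl_self]
      _ ≤ _ := measure_union_le _ _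
      _ ≤ _ := by gcongr
  exact (ENNReal.add_le_add_iff_right (measure_ne_top _ _)).mp h3

end SCF
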